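/- arXiv:2110.10365 — 5 statements merged into one kernel-verified Lean document; each statement's English description precedes it below -/
import Mathlib

section
/- Let n ≥ 1 be an integer, T ≥ 1, m > 0, r > 3 real, C_R ≥ 1/m, β ∈ (0,1] and g₀ ≥ 0. Let (u_l)_{l≥1} be real numbers with |u_l − 1/m| ≤ C_R (l+1)^{−(r−1)} for all l ≥ 1; set u⁰₀ := 0 and u⁰_l := u_l for l ≥ 1, and suppose that the two-sided series Σ_{j∈ℤ} (u⁰_{|j|} − 1/m) converges absolutely with sum S. Let G : ℝ → [0,1] be nondecreasing with G(t) = 0 for t < 0 and G(t) − G(s) ≤ g₀ (t−s)^β for all 0 < s < t ≤ T, and put Ḡ := 1 − G. Then there exists a constant C depending only on C_R, r, β, g₀ such that for every integer i with 1 ≤ i ≤ ⌊nT⌋ and every s ∈ [0,T]: | Σ_{j=1}^{⌊ns⌋} (u⁰_{|j−i|} − 1/m) Ḡ(s − j/n) − 1[s ≥ i/n]·Ḡ(s − i/n)·S | ≤ C ( n^{−β} + (|i − ⌊ns⌋| + 1)^{−(r−2)} + i^{−(r−2)} ). -/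
open Set MeasureTheory Filter
open scoped NNReal ENNReal

/-- One step of the comparison of `∑ x ^ (-(p + 1))` with a telescoping sum. -/
lemma rpow_neg_succ_le_sub {p x : ℝ} (hp : 1 ≤ p) (hx : 0 < x) :
    (x + 1) ^ (-(p + 1)) ≤ x ^ (-p) - (x + 1) ^ (-p) := by
  have hx1 : 0 < x + 1 := by linarith
  have hB : 1 + p * (1 / x) ≤ (1 + 1 / x) ^ p :=
    one_add_mul_self_le_rpow_one_add (by have : 0 < 1 / x := by positivity
                                         linarith) hp
  have hxe : 1 + 1 / x = (x + 1) / x := by field_simp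
  rw [hxe, Real.div_rpow hx1.le hx.le] at hB
  have hxp : 0 < x ^ p := Real.rpow_pos_of_pos hx p
  have hyp : 0 < (x + 1) ^ p := Real.rpow_pos_of_pos hx1 p
  have h1 : 1 / (x + 1) ≤ p * (1 / x) := by
    calc 1 / (x + 1) ≤ 1 / x := one_div_le_one_div_of_le hx (by linarith)
      _ ≤ p * (1 / x) := le_mul_of_one_le_left (by positivity) hp
  rw [neg_add, Real.rpow_add hx1, Real.rpow_neg hx1.le, Real.rpow_neg hx.le,
    Real.rpow_neg_one]
  have h2 : (x + 1) ^ p / x ^ p * ((x + 1) ^ p)⁻¹ = (x ^ p)⁻¹ := by field_simp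
  have h3 : (1 + 1 / (x + 1)) * ((x + 1) ^ p)⁻¹ ≤ (x ^ p)⁻¹ := by
    rw [← h2]
    exact mul_le_mul_of_nonneg_right (by linarith) (by positivity)
  rw [one_div] at h3
  linarith

lemma sum_Ico_rpow_neg_succ_le {p : ℝ} (hp : 1 ≤ p) {M L : ℕ} (hM : 1 ≤ M) (hL : M ≤ L) :
    ∑ k ∈ Finset.Ico M L, ((k : ℝ) + 1) ^ (-(p + 1)) ≤ (M : ℝ) ^ (-p) - (L : ℝ) ^ (-p) := by
  induction L, hL using Nat.le_induction with
  | base => simp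
  | succ L hL ih =>
    rw [Finset.sum_Ico_succ_top hL]
    have hL0 : (0 : ℝ) < L := by exact_mod_cast lt_of_lt_of_le hM hL
    have := rpow_neg_succ_le_sub hp hL0
    push_cast
    linarith

/-- A tail of `∑ (k + 1) ^ (-(p + 1))` starting at `M` is at most `M ^ (-p)`. -/
lemma sum_rpow_neg_succ_le_of_injOn {ι : Type*} {p : ℝ} (hp : 1 ≤ p) {M : ℕ} (hM : 1 ≤ M)
    (F : Finset ι) (f : ι → ℕ) (hf : Set.InjOn f F) (hFM : ∀ x ∈ F, M ≤ f x) :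
    ∑ x ∈ F, ((f x : ℝ) + 1) ^ (-(p + 1)) ≤ (M : ℝ) ^ (-p) := by
  have hsub : F.image f ⊆ Finset.Ico M (max M (F.sup f + 1)) := by
    intro k hk
    obtain ⟨x, hx, rfl⟩ := Finset.mem_image.1 hk
    have := Finset.le_sup (f := f) hx
    have := hFM x hx
    simp only [Finset.mem_Ico]
    omega
  rw [← Finset.sum_image (f := fun k : ℕ => ((k : ℝ) + 1) ^ (-(p + 1))) hf]
  calc _ ≤ ∑ k ∈ Finset.Ico M (max M (F.sup f + 1)), ((k : ℝ) + 1) ^ (-(p + 1)) :=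
        Finset.sum_le_sum_of_subset_of_nonneg hsub fun _ _ _ => by positivity
    _ ≤ _ := sum_Ico_rpow_neg_succ_le hp hM (le_max_left _ _)
    _ ≤ _ := sub_le_self _ (by positivity)

lemma summable_int_natAbs_add_one_rpow_neg {p : ℝ} (hp : 1 < p) :
    Summable fun k : ℤ => ((k.natAbs : ℝ) + 1) ^ (-p) := by
  have h : Summable fun k : ℕ => ((k : ℝ) + 1) ^ (-p) := by
    have := (summable_nat_add_iff 1).2 (Real.summable_nat_rpow (p := -p).2 (by linarith))
    simpa using this
  refine Summable.of_nat_of_neg ?_ ?_ <;> simpa using h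

/-- Deviation of a monotone `[0,1]`-valued function that is Hölder on `(0, T]` between two points
of the grid `s - j / n`, with the possible jump at `0` accounted for separately. -/
lemma abs_sub_grid_le {G : ℝ → ℝ} {T s g₀ β : ℝ} {n : ℕ} (hn : 1 ≤ n) (hg₀ : 0 ≤ g₀)
    (hG01 : ∀ t, 0 ≤ G t ∧ G t ≤ 1) (hGmono : Monotone G)
    (hG : ∀ s t : ℝ, 0 < s → s < t → t ≤ T → G t - G s ≤ g₀ * (t - s) ^ β)
    (hsT : s ≤ T) {i j : ℤ} (hi1 : 1 ≤ i) (hj1 : 1 ≤ j)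
    (hi : i ≤ ⌊(n : ℝ) * s⌋) (hj : j ≤ ⌊(n : ℝ) * s⌋) :
    |G (s - (i : ℝ) / n) - G (s - (j : ℝ) / n)| ≤
      g₀ * (((j - i).natAbs : ℝ) ^ β * (n : ℝ) ^ (-β)) +
        ((if j = ⌊(n : ℝ) * s⌋ then 1 else 0) + (if i = ⌊(n : ℝ) * s⌋ then 1 else 0)) := by
  have hn0 : (0 : ℝ) < n := by exact_mod_cast hn
  have hmain : 0 ≤ g₀ * (((j - i).natAbs : ℝ) ^ β * (n : ℝ) ^ (-β)) := by positivity
  have hone : |G (s - (i : ℝ) / n) - G (s - (j : ℝ) / n)| ≤ 1 := by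
    have h1 := hG01 (s - (i : ℝ) / n)
    have h2 := hG01 (s - (j : ℝ) / n)
    rw [abs_le]; constructor <;> linarith
  by_cases hjN : j = ⌊(n : ℝ) * s⌋
  · rw [if_pos hjN]
    split_ifs <;> linarith
  by_cases hiN : i = ⌊(n : ℝ) * s⌋
  · rw [if_pos hiN, if_neg hjN]
    linarith
  rw [if_neg hjN, if_neg hiN]
  have hpos : ∀ k : ℤ, k ≤ ⌊(n : ℝ) * s⌋ → k ≠ ⌊(n : ℝ) * s⌋ → 0 < s - (k : ℝ) / n := by
    intro k hk hk'
    have h1 : (k : ℝ) + 1 ≤ ⌊(n : ℝ) * s⌋ := by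
      exact_mod_cast (lt_of_le_of_ne hk hk' : k < _)
    have h2 := Int.floor_le ((n : ℝ) * s)
    rw [sub_pos, div_lt_iff₀ hn0]
    linarith
  have hT : ∀ k : ℤ, 1 ≤ k → s - (k : ℝ) / n ≤ T := by
    intro k hk
    have : (0 : ℝ) ≤ (k : ℝ) / n := div_nonneg (by exact_mod_cast (by omega : (0 : ℤ) ≤ k)) hn0.le
    linarith
  have key : ∀ a b : ℤ, 1 ≤ a → b ≤ ⌊(n : ℝ) * s⌋ → b ≠ ⌊(n : ℝ) * s⌋ → a < b →
      |G (s - (a : ℝ) / n) - G (s - (b : ℝ) / n)| ≤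
        g₀ * (((b - a).natAbs : ℝ) ^ β * (n : ℝ) ^ (-β)) := by
    intro a b ha hb hb' hab
    have hab' : (a : ℝ) < b := by exact_mod_cast hab
    have hlt : s - (b : ℝ) / n < s - (a : ℝ) / n :=
      sub_lt_sub_left (div_lt_div_of_pos_right hab' hn0) s
    rw [abs_of_nonneg (sub_nonneg.2 (hGmono hlt.le))]
    refine (hG _ _ (hpos b hb hb') hlt (hT a ha)).trans_eq ?_
    have hc : ((b - a).natAbs : ℝ) = (b : ℝ) - a := by
      rw [Nat.cast_natAbs, abs_of_pos (by omega)]; push_cast; rfl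
    have he : s - (a : ℝ) / n - (s - (b : ℝ) / n) = ((b : ℝ) - a) / n := by ring
    rw [hc, he, Real.div_rpow (by linarith) hn0.le, Real.rpow_neg hn0.le, div_eq_mul_inv]
  rw [add_zero, add_zero]
  rcases lt_trichotomy i j with h | h | h
  · exact key i j hi1 hj hjN h
  · rw [h, sub_self, abs_zero, ← h]; simpa [h] using hmain
  · rw [abs_sub_comm, ← Int.natAbs_neg, neg_sub]
    exact key j i hj1 hi hiN h

lemma abs_sum_mul_sub_grid_le {G : ℝ → ℝ} {T s g₀ β p C_R : ℝ} {n : ℕ} (hn : 1 ≤ n)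
    (hg₀ : 0 ≤ g₀) (hβ0 : 0 < β) (hβ1 : β ≤ 1) (hp : 1 < p) (hC : 0 ≤ C_R)
    (hG01 : ∀ t, 0 ≤ G t ∧ G t ≤ 1) (hGmono : Monotone G)
    (hG : ∀ s t : ℝ, 0 < s → s < t → t ≤ T → G t - G s ≤ g₀ * (t - s) ^ β)
    (hsT : s ≤ T) {a : ℤ → ℝ}
    (ha : ∀ k, |a k| ≤ C_R * ((k.natAbs : ℝ) + 1) ^ (-(p + 1)))
    {i : ℤ} (hi1 : 1 ≤ i) (hi : i ≤ ⌊(n : ℝ) * s⌋) :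
    |∑ j ∈ Finset.Icc (1 : ℤ) ⌊(n : ℝ) * s⌋,
        a (j - i) * (G (s - (i : ℝ) / n) - G (s - (j : ℝ) / n))| ≤
      C_R * (g₀ * (∑' k : ℤ, ((k.natAbs : ℝ) + 1) ^ (-p)) * (n : ℝ) ^ (-β) +
        (1 + ∑' k : ℤ, ((k.natAbs : ℝ) + 1) ^ (-p)) *
          (((⌊(n : ℝ) * s⌋ - i).natAbs : ℝ) + 1) ^ (-p)) := by
  set N := ⌊(n : ℝ) * s⌋ with hN
  set W := ∑' k : ℤ, ((k.natAbs : ℝ) + 1) ^ (-p) with hW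
  set v : ℤ → ℝ := fun k => ((k.natAbs : ℝ) + 1) ^ (-p) with hv
  have hv0 : ∀ k, 0 ≤ v k := fun k => by positivity
  have hn0 : (0 : ℝ) < n := by exact_mod_cast hn
  have hvs : Summable v := summable_int_natAbs_add_one_rpow_neg hp
  have hWF : ∑ j ∈ Finset.Icc (1 : ℤ) N, v (j - i) ≤ W := by
    have hs : Summable fun j => v (j - i) := (Equiv.subRight i).summable_iff.2 hvs
    refine (hs.sum_le_tsum _ fun j _ => hv0 _).trans_eq ?_
    exact (Equiv.subRight i).tsum_eq v
  have hterm : ∀ j ∈ Finset.Icc (1 : ℤ) N,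
      |a (j - i) * (G (s - (i : ℝ) / n) - G (s - (j : ℝ) / n))| ≤
        C_R * (g₀ * (n : ℝ) ^ (-β) * v (j - i) + ((if j = N then v (j - i) else 0) +
          (if i = N then 1 else 0) * v (j - i))) := by
    intro j hj
    obtain ⟨hj1, hjN⟩ := Finset.mem_Icc.1 hj
    have hd := abs_sub_grid_le hn hg₀ hG01 hGmono hG hsT hi1 hj1 hi hjN
    rw [← hN] at hd
    set x : ℝ := ((j - i).natAbs : ℝ) with hx
    have hx0 : 0 ≤ x := Nat.cast_nonneg _
    have hsplit : (x + 1) ^ (-p) = (x + 1) ^ (-(p + 1)) * (x + 1) := by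
      rw [← Real.rpow_add_one (by positivity)]; congr 1; ring
    have hw0 : 0 ≤ (x + 1) ^ (-(p + 1)) := by positivity
    have hwv : (x + 1) ^ (-(p + 1)) ≤ v (j - i) := by
      rw [hv]; exact Real.rpow_le_rpow_of_exponent_le (by linarith) (by linarith)
    have hxb : x ^ β ≤ x + 1 :=
      (Real.rpow_le_rpow hx0 (by linarith) hβ0.le).trans
        ((Real.rpow_le_rpow_of_exponent_le (by linarith) hβ1).trans_eq (Real.rpow_one _))
    have hwx : (x + 1) ^ (-(p + 1)) * x ^ β ≤ v (j - i) :=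
      (mul_le_mul_of_nonneg_left hxb hw0).trans_eq hsplit.symm
    have hgn : 0 ≤ g₀ * (n : ℝ) ^ (-β) := by positivity
    rw [abs_mul]
    calc _ ≤ C_R * (x + 1) ^ (-(p + 1)) * _ :=
          mul_le_mul (ha _) hd (abs_nonneg _) (by positivity)
      _ = C_R * (g₀ * (n : ℝ) ^ (-β) * ((x + 1) ^ (-(p + 1)) * x ^ β) +
            ((if j = N then (x + 1) ^ (-(p + 1)) else 0) +
              (if i = N then 1 else 0) * (x + 1) ^ (-(p + 1)))) := by
          split_ifs <;> ring
      _ ≤ _ := by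
          refine mul_le_mul_of_nonneg_left (add_le_add
            (mul_le_mul_of_nonneg_left hwx hgn) (add_le_add ?_ ?_)) hC
          · split_ifs
            exacts [hwv, le_rfl]
          · exact mul_le_mul_of_nonneg_left hwv (by split_ifs <;> norm_num)
  refine (Finset.abs_sum_le_sum_abs _ _).trans ((Finset.sum_le_sum hterm).trans ?_)
  rw [← Finset.mul_sum, Finset.sum_add_distrib, Finset.sum_add_distrib, ← Finset.mul_sum,
    ← Finset.mul_sum, Finset.sum_ite_eq' _ N (fun j => v (j - i)),
    if_pos (Finset.mem_Icc.2 ⟨hi1.trans hi, le_rfl⟩)]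
  have hjump : (if i = N then (1 : ℝ) else 0) * ∑ j ∈ Finset.Icc (1 : ℤ) N, v (j - i) ≤
      W * v (N - i) := by
    split_ifs with h
    · have h1 : v (N - i) = 1 := by simp [hv, h]
      rw [h1]; linarith
    · have : 0 ≤ W := tsum_nonneg hv0
      rw [zero_mul]; exact mul_nonneg this (hv0 _)
  have hgn : 0 ≤ g₀ * (n : ℝ) ^ (-β) := by positivity
  have := mul_le_mul_of_nonneg_left hWF hgn
  refine mul_le_mul_of_nonneg_left ?_ hC
  change _ ≤ g₀ * W * (n : ℝ) ^ (-β) + (1 + W) * v (N - i)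
  linarith

lemma abs_sum_Icc_sub_tsum_le {p C_R : ℝ} (hp : 1 ≤ p) (hC : 0 ≤ C_R) {a : ℤ → ℝ}
    (ha : ∀ k, |a k| ≤ C_R * ((k.natAbs : ℝ) + 1) ^ (-(p + 1))) (hs : Summable a)
    {i N : ℤ} (hi1 : 1 ≤ i) (hi : i ≤ N) :
    |∑ j ∈ Finset.Icc (1 : ℤ) N, a (j - i) - ∑' k, a k| ≤
      C_R * ((i : ℝ) ^ (-p) + (((N - i).natAbs : ℝ) + 1) ^ (-p)) := by
  have hsum : HasSum (fun j => a (j - i)) (∑' k, a k) :=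
    (Equiv.subRight i).hasSum_iff.2 hs.hasSum
  have hlim : Tendsto (fun F : Finset ℤ =>
      |∑ j ∈ Finset.Icc (1 : ℤ) N, a (j - i) - ∑ j ∈ F, a (j - i)|) atTop
      (nhds |∑ j ∈ Finset.Icc (1 : ℤ) N, a (j - i) - ∑' k, a k|) :=
    (tendsto_const_nhds.sub hsum).abs
  refine le_of_tendsto hlim ?_
  filter_upwards [eventually_ge_atTop (Finset.Icc (1 : ℤ) N)] with F hF
  rw [abs_sub_comm, ← Finset.sum_sdiff hF, add_sub_cancel_right]
  refine (Finset.abs_sum_le_sum_abs _ _).trans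
    ((Finset.sum_le_sum fun j _ => ha (j - i)).trans ?_)
  rw [← Finset.mul_sum]
  refine mul_le_mul_of_nonneg_left ?_ hC
  rw [← Finset.sum_filter_add_sum_filter_not _ (fun j : ℤ => j ≤ 0)]
  refine add_le_add ?_ ?_
  · have hc : ((i.natAbs : ℕ) : ℝ) = (i : ℝ) := by
      rw [Nat.cast_natAbs, abs_of_pos (by omega)]
    rw [← hc]
    refine sum_rpow_neg_succ_le_of_injOn hp (by omega) _ _ ?_ ?_
    · intro x hx y hy hxy
      simp only [Finset.coe_filter, Set.mem_ofPred_eq] at hx hy hxy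
      omega
    · intro x hx
      have := (Finset.mem_filter.1 hx).2
      omega
  · have hmem : ∀ x ∈ {j ∈ F \ Finset.Icc (1 : ℤ) N | ¬ j ≤ 0}, N < x := by
      intro x hx
      simp only [Finset.mem_filter, Finset.mem_sdiff, Finset.mem_Icc] at hx
      omega
    have := sum_rpow_neg_succ_le_of_injOn hp (M := (N - i).natAbs + 1) (by omega)
      {j ∈ F \ Finset.Icc (1 : ℤ) N | ¬ j ≤ 0} (fun j => (j - i).natAbs) ?_ ?_
    · push_cast at this ⊢; exact this
    · intro x hx y hy hxy
      have := hmem x hx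
      have := hmem y hy
      simp only at hxy
      omega
    · intro x hx
      have := hmem x hx
      omega

lemma abs_sum_Icc_mul_le_of_lt {p C_R : ℝ} (hp : 1 ≤ p) (hC : 0 ≤ C_R) {a b : ℤ → ℝ}
    (ha : ∀ k, |a k| ≤ C_R * ((k.natAbs : ℝ) + 1) ^ (-(p + 1))) (hb : ∀ k, |b k| ≤ 1)
    {i N : ℤ} (hi : N < i) :
    |∑ j ∈ Finset.Icc (1 : ℤ) N, a (j - i) * b j| ≤
      C_R * (2 ^ p * (((N - i).natAbs : ℝ) + 1) ^ (-p)) := by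
  have hterm : ∀ j ∈ Finset.Icc (1 : ℤ) N,
      |a (j - i) * b j| ≤ C_R * (((j - i).natAbs : ℝ) + 1) ^ (-(p + 1)) := by
    intro j _
    rw [abs_mul]
    exact (mul_le_of_le_one_right (abs_nonneg _) (hb j)).trans (ha _)
  refine (Finset.abs_sum_le_sum_abs _ _).trans ((Finset.sum_le_sum hterm).trans ?_)
  rw [← Finset.mul_sum]
  refine mul_le_mul_of_nonneg_left ?_ hC
  refine (sum_rpow_neg_succ_le_of_injOn hp (M := (N - i).natAbs) (by omega) _
    (fun j => (j - i).natAbs) ?_ ?_).trans ?_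
  · intro x hx y hy hxy
    simp only [Finset.coe_Icc, Set.mem_Icc] at hx hy hxy
    omega
  · intro x hx
    have := Finset.mem_Icc.1 hx
    omega
  · have hd : (1 : ℝ) ≤ ((N - i).natAbs : ℝ) := by
      exact_mod_cast (by omega : 1 ≤ (N - i).natAbs)
    set d : ℝ := ((N - i).natAbs : ℝ)
    have h2 : (2 : ℝ) ^ p = ((1 / 2 : ℝ)) ^ (-p) := by
      rw [Real.rpow_neg (by norm_num), one_div, Real.inv_rpow (by norm_num), inv_inv]
    rw [h2, ← Real.mul_rpow (by norm_num) (by linarith)]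
    exact Real.rpow_le_rpow_of_nonpos (by linarith) (by linarith) (by linarith)

/-- Analytic core of the comparison of means for the GI/GI/∞ queue: if the renewal
probabilities `u_l` satisfy `|u_l - 1/m| ≤ C_R (l+1)^{-(r-1)}`, the two-sided series
`Σ_{j∈ℤ}(u⁰_{|j|} - 1/m)` converges absolutely to `S`, and `G` satisfies the stated Hölder
condition, then there is a constant `C = C(C_R, r, β, g₀)` such that for all `1 ≤ i ≤ ⌊nT⌋`
and `s ∈ [0,T]`,
`|Σ_{j=1}^{⌊ns⌋}(u⁰_{|j-i|} - 1/m) Ḡ(s-j/n) - 1[s ≥ i/n] Ḡ(s-i/n) S|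
   ≤ C (n^{-β} + (|i-⌊ns⌋|+1)^{-(r-2)} + i^{-(r-2)})`. -/
theorem stmt10 (C_R r β g₀ : ℝ) (hr : 3 < r) (hβ0 : 0 < β) (hβ1 : β ≤ 1) (hg₀ : 0 ≤ g₀) :
    ∃ C : ℝ, ∀ (n : ℕ) (T m S : ℝ) (u : ℕ → ℝ) (G : ℝ → ℝ),
      1 ≤ n → 1 ≤ T → 0 < m → 1 / m ≤ C_R →
      (∀ l : ℕ, 1 ≤ l → |u l - 1 / m| ≤ C_R * ((l : ℝ) + 1) ^ (-(r - 1))) →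
      Summable (fun j : ℤ => |(if j = 0 then 0 else u j.natAbs) - 1 / m|) →
      S = ∑' j : ℤ, ((if j = 0 then 0 else u j.natAbs) - 1 / m) →
      Monotone G → (∀ t, 0 ≤ G t ∧ G t ≤ 1) → (∀ t, t < 0 → G t = 0) →
      (∀ s t : ℝ, 0 < s → s < t → t ≤ T → G t - G s ≤ g₀ * (t - s) ^ β) →
      ∀ (i : ℤ) (s : ℝ), 1 ≤ i → i ≤ ⌊(n : ℝ) * T⌋ → s ∈ Set.Icc (0:ℝ) T →
        |(∑ j ∈ Finset.Icc (1 : ℤ) ⌊(n : ℝ) * s⌋,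
              ((if j = i then 0 else u (j - i).natAbs) - 1 / m) * (1 - G (s - (j : ℝ) / n)))
            - (if (i : ℝ) / n ≤ s then (1 - G (s - (i : ℝ) / n)) * S else 0)|
          ≤ C * ((n : ℝ) ^ (-β) + (((|i - ⌊(n : ℝ) * s⌋| : ℤ) : ℝ) + 1) ^ (-(r - 2))
              + (i : ℝ) ^ (-(r - 2))) := by
  set p : ℝ := r - 2 with hp
  have hp1 : 1 < p := by rw [hp]; linarith
  have hrp : r - 1 = p + 1 := by rw [hp]; ring
  set W : ℝ := ∑' k : ℤ, ((k.natAbs : ℝ) + 1) ^ (-p) with hW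
  have hW0 : 0 ≤ W := tsum_nonneg fun k => by positivity
  refine ⟨C_R * (2 ^ p + g₀ * W + W + 2), ?_⟩
  intro n T m S u G hn hT hm hmC hu hsum hS hGmono hG01 hGneg hG i s hi1 hiT hs
  have hn0 : (0 : ℝ) < n := by exact_mod_cast hn
  have hC : 0 ≤ C_R := le_trans (by positivity) hmC
  set N := ⌊(n : ℝ) * s⌋ with hN
  set a : ℤ → ℝ := fun k => (if k = 0 then 0 else u k.natAbs) - 1 / m with ha_def
  have ha : ∀ k, |a k| ≤ C_R * ((k.natAbs : ℝ) + 1) ^ (-(p + 1)) := by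
    intro k
    by_cases hk : k = 0
    · simpa [ha_def, hk, abs_of_pos hm] using hmC
    · simp only [ha_def, if_neg hk]
      rw [← hrp]
      exact hu _ (by omega)
  have hsa : Summable a := summable_abs_iff.1 hsum
  have hterm : ∀ j : ℤ, (if j = i then 0 else u (j - i).natAbs) - 1 / m = a (j - i) := by
    intro j
    simp only [ha_def, sub_eq_zero]
  simp only [hterm]
  have hcond : (i : ℝ) / n ≤ s ↔ i ≤ N := by
    rw [hN, Int.le_floor, div_le_iff₀ hn0, mul_comm s]
  have hA : (((|i - N| : ℤ) : ℝ) + 1) = ((N - i).natAbs : ℝ) + 1 := by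
    rw [Nat.cast_natAbs, abs_sub_comm]
  rw [hA]
  have hiR : (0 : ℝ) ≤ i := by exact_mod_cast (by omega : (0 : ℤ) ≤ i)
  set A : ℝ := (((N - i).natAbs : ℝ) + 1) ^ (-p) with hA_def
  have hA0 : 0 ≤ A := by positivity
  have hB0 : 0 ≤ (i : ℝ) ^ (-p) := by positivity
  have hD0 : 0 ≤ (n : ℝ) ^ (-β) := by positivity
  set B : ℝ := (i : ℝ) ^ (-p)
  set D : ℝ := (n : ℝ) ^ (-β)
  have h2p : (0 : ℝ) ≤ 2 ^ p := by positivity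
  have hbar : ∀ t, |1 - G t| ≤ 1 := fun t => by
    have := hG01 t
    rw [abs_le]; constructor <;> linarith
  have hgW : 0 ≤ g₀ * W := mul_nonneg hg₀ hW0
  rw [mul_assoc]
  by_cases hiN : i ≤ N
  · rw [if_pos (hcond.2 hiN)]
    have h1 := abs_sum_mul_sub_grid_le hn hg₀ hβ0 hβ1 hp1 hC hG01 hGmono hG hs.2 ha hi1 hiN
    have h2 := abs_sum_Icc_sub_tsum_le hp1.le hC ha hsa hi1 hiN
    rw [← hS] at h2
    have hdecomp : ∑ j ∈ Finset.Icc (1 : ℤ) N, a (j - i) * (1 - G (s - (j : ℝ) / n)) -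
          (1 - G (s - (i : ℝ) / n)) * S =
        ∑ j ∈ Finset.Icc (1 : ℤ) N, a (j - i) * (G (s - (i : ℝ) / n) - G (s - (j : ℝ) / n)) +
          (1 - G (s - (i : ℝ) / n)) * (∑ j ∈ Finset.Icc (1 : ℤ) N, a (j - i) - S) := by
      rw [mul_sub, Finset.mul_sum, ← add_sub_assoc, ← Finset.sum_add_distrib]
      congr 1
      exact Finset.sum_congr rfl fun j _ => by ring
    rw [hdecomp]
    refine (abs_add_le _ _).trans ?_
    rw [abs_mul]
    refine (add_le_add h1 ((mul_le_of_le_one_left (abs_nonneg _) (hbar _)).trans h2)).trans ?_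
    rw [← mul_add]
    refine mul_le_mul_of_nonneg_left ?_ hC
    change g₀ * W * D + (1 + W) * A + (B + A) ≤ _
    nlinarith [mul_nonneg h2p hA0, mul_nonneg h2p hB0, mul_nonneg h2p hD0,
      mul_nonneg hgW hA0, mul_nonneg hgW hB0, mul_nonneg hW0 hB0, mul_nonneg hW0 hD0]
  · rw [if_neg (fun h => hiN (hcond.1 h)), sub_zero]
    refine (abs_sum_Icc_mul_le_of_lt hp1.le hC ha
      (fun j => hbar (s - (j : ℝ) / n)) (not_le.1 hiN)).trans ?_
    refine mul_le_mul_of_nonneg_left ?_ hC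
    exact mul_le_mul (by linarith) (by linarith) hA0 (by linarith)
end

section
/- Let T > 0, let α be a finite measure on [0,T] with α({0}) = 0, let G and G̃ be cumulative distribution functions of probability measures μ_G and μ_G̃ on [0,∞), and let x ≥ 0. On S = [0,T]×[0,∞) define Λ := (α × μ_G) + x·(δ₀ × μ_G̃), and define Ĵ_{(t,y)}(s) := 1[t ≤ s < t+y] for t > 0 and Ĵ_{(0,y)}(s) := 1[0 ≤ s < y] − (1 − G̃(s)). Then for all 0 ≤ s₁ ≤ s₂ ≤ T: ∫_S Ĵ_{(t,y)}(s₁) Ĵ_{(t,y)}(s₂) Λ(dt,dy) = ∫_{[0,s₁]} (1 − G(s₂ − t)) α(dt) + x · G̃(s₁) (1 − G̃(s₂)). -/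
open Set MeasureTheory Filter
open scoped NNReal ENNReal

/-- The survival function of a probability measure as the integral of an indicator. -/
lemma integral_ite_lt_eq_one_sub (μ : Measure ℝ) [IsProbabilityMeasure μ] (u : ℝ) :
    ∫ y, (if u < y then (1 : ℝ) else 0) ∂μ = 1 - (μ (Set.Iic u)).toReal := by
  have h : (fun y : ℝ => if u < y then (1 : ℝ) else 0) = (Set.Ioi u).indicator 1 := by
    ext y
    simp [Set.indicator_apply]
  rw [h, integral_indicator_one measurableSet_Ioi, ← Set.compl_Iic,
    probReal_compl_eq_one_sub measurableSet_Iic, Measure.real]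

lemma integrable_ite_lt (μ : Measure ℝ) [IsFiniteMeasure μ] (u : ℝ) :
    Integrable (fun y : ℝ => if u < y then (1 : ℝ) else 0) μ := by
  refine Integrable.of_bound
    (Measurable.ite measurableSet_Ioi measurable_const measurable_const).aestronglyMeasurable 1
    (ae_of_all _ fun y => ?_)
  split_ifs <;> simp

/-- Covariance of two centred exceedance indicators. -/
lemma integral_centered_ite_lt_mul (μ : Measure ℝ) [IsProbabilityMeasure μ] {u v : ℝ}
    (huv : u ≤ v) :
    ∫ y, ((if u < y then (1 : ℝ) else 0) - (1 - (μ (Set.Iic u)).toReal)) *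
        ((if v < y then (1 : ℝ) else 0) - (1 - (μ (Set.Iic v)).toReal)) ∂μ
      = (μ (Set.Iic u)).toReal * (1 - (μ (Set.Iic v)).toReal) := by
  have hu := integral_ite_lt_eq_one_sub μ u
  have hv := integral_ite_lt_eq_one_sub μ v
  have hiu := integrable_ite_lt μ u
  have hiv := integrable_ite_lt μ v
  generalize (μ (Set.Iic u)).toReal = a at *
  generalize (μ (Set.Iic v)).toReal = b at *
  have h : ∀ y : ℝ, ((if u < y then (1 : ℝ) else 0) - (1 - a)) *
      ((if v < y then (1 : ℝ) else 0) - (1 - b))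
      = a * (if v < y then (1 : ℝ) else 0) - (1 - b) * (if u < y then (1 : ℝ) else 0)
        + (1 - a) * (1 - b) := by
    intro y
    by_cases h1 : v < y
    · simp only [h1, huv.trans_lt h1, if_true]
      ring
    · simp only [h1, if_false]
      ring
  simp_rw [h]
  have hsub : Integrable (fun y : ℝ => a * (if v < y then (1 : ℝ) else 0)
      - (1 - b) * (if u < y then (1 : ℝ) else 0)) μ := (hiv.const_mul _).sub (hiu.const_mul _)
  rw [integral_add hsub (integrable_const _), integral_sub (hiv.const_mul _) (hiu.const_mul _),
    integral_const_mul, integral_const_mul, hu, hv]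
  simp only [integral_const, probReal_univ, one_smul]
  ring

/-- Covariance identity for the Gaussian limit of the heavy-traffic M/GI/∞ queue:
`∫_S Ĵ_{(t,y)}(s₁) Ĵ_{(t,y)}(s₂) Λ(dt,dy) = ∫_{[0,s₁]}(1-G(s₂-t)) α(dt) + x G̃(s₁)(1-G̃(s₂))`
for `0 ≤ s₁ ≤ s₂ ≤ T`. -/
theorem stmt14 (T : ℝ) (hT : 0 < T)
    (α : Measure ℝ) [IsFiniteMeasure α]
    (hαsupp : α (Set.Icc (0:ℝ) T)ᶜ = 0) (hα0 : α {(0:ℝ)} = 0)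
    (μG μG' : Measure ℝ) [IsProbabilityMeasure μG] [IsProbabilityMeasure μG']
    (hμG : μG (Set.Iio (0:ℝ)) = 0) (hμG' : μG' (Set.Iio (0:ℝ)) = 0)
    (G Gt : ℝ → ℝ)
    (hGdef : ∀ u, G u = (μG (Set.Iic u)).toReal)
    (hGtdef : ∀ u, Gt u = (μG' (Set.Iic u)).toReal)
    (x : ℝ) (hx : 0 ≤ x)
    (Λ : Measure (ℝ × ℝ))
    (hΛ : Λ = α.prod μG + ENNReal.ofReal x • ((Measure.dirac (0:ℝ)).prod μG'))
    (Jhat : ℝ × ℝ → ℝ → ℝ)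
    (hJhat : ∀ t y s : ℝ, Jhat (t, y) s =
      if 0 < t then (if t ≤ s ∧ s < t + y then 1 else 0)
      else ((if 0 ≤ s ∧ s < y then 1 else 0) - (1 - Gt s)))
    (s₁ s₂ : ℝ) (h0 : 0 ≤ s₁) (h12 : s₁ ≤ s₂) (h2T : s₂ ≤ T) :
    ∫ q, Jhat q s₁ * Jhat q s₂ ∂Λ
      = (∫ t in Set.Icc (0:ℝ) s₁, (1 - G (s₂ - t)) ∂α) + x * Gt s₁ * (1 - Gt s₂) := by
  have hmeas : ∀ s, Measurable fun q => Jhat q s := by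
    intro s
    have h : (fun q => Jhat q s) = fun q : ℝ × ℝ =>
        if 0 < q.1 then (if q.1 ≤ s ∧ s < q.1 + q.2 then 1 else 0)
        else ((if 0 ≤ s ∧ s < q.2 then 1 else 0) - (1 - Gt s)) :=
      funext fun q => hJhat q.1 q.2 s
    rw [h]
    refine Measurable.ite (measurableSet_lt measurable_const measurable_fst)
      (Measurable.ite ?_ measurable_const measurable_const)
      ((Measurable.ite ?_ measurable_const measurable_const).sub measurable_const)
    · exact (measurableSet_le measurable_fst measurable_const).inter
        (measurableSet_lt measurable_const (measurable_fst.add measurable_snd))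
    · exact (MeasurableSet.const _).inter (measurableSet_lt measurable_const measurable_snd)
  have hbound : ∀ s q, ‖Jhat q s‖ ≤ 1 := by
    rintro s ⟨t, y⟩
    have h₀ : 0 ≤ Gt s := by
      rw [hGtdef]
      exact ENNReal.toReal_nonneg
    have h₁ : Gt s ≤ 1 := by
      rw [hGtdef]
      exact measureReal_le_one
    rw [hJhat, Real.norm_eq_abs, abs_le]
    split_ifs <;> constructor <;> linarith
  have hint : ∀ (ν : Measure (ℝ × ℝ)) [IsFiniteMeasure ν],
      Integrable (fun q => Jhat q s₁ * Jhat q s₂) ν := by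
    intro ν _
    refine Integrable.of_bound ((hmeas s₁).mul (hmeas s₂)).aestronglyMeasurable 1
      (ae_of_all _ fun q => ?_)
    rw [norm_mul]
    exact mul_le_one₀ (hbound _ _) (norm_nonneg _) (hbound _ _)
  have hpos : ∀ᵐ t ∂α, 0 < t := by
    have h1 : ∀ᵐ t ∂α, t ∈ Set.Icc (0 : ℝ) T := hαsupp
    have h2 : ∀ᵐ t ∂α, t ≠ 0 := by
      simpa [ae_iff] using hα0
    filter_upwards [h1, h2] with t ht ht0
    exact lt_of_le_of_ne ht.1 ht0.symm
  have harrival : ∫ q, Jhat q s₁ * Jhat q s₂ ∂(α.prod μG)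
      = ∫ t in Set.Icc (0 : ℝ) s₁, (1 - G (s₂ - t)) ∂α := by
    rw [integral_prod _ (hint _), ← integral_indicator measurableSet_Icc]
    refine integral_congr_ae ?_
    filter_upwards [hpos] with t ht
    by_cases hts : t ≤ s₁
    · rw [Set.indicator_of_mem (Set.mem_Icc.2 ⟨ht.le, hts⟩), hGdef,
        ← integral_ite_lt_eq_one_sub]
      refine integral_congr_ae (ae_of_all _ fun y => ?_)
      by_cases hy : s₂ - t < y
      · have hy₂ : s₂ < t + y := by linarith
        simp [hJhat, ht, hts, hts.trans h12, hy, hy₂, h12.trans_lt hy₂]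
      · have hy₂ : ¬ s₂ < t + y := by linarith
        simp [hJhat, ht, hy, hy₂]
    · rw [Set.indicator_of_notMem fun h => hts h.2]
      simp [hJhat, ht, hts]
  have hinitial : ∫ q, Jhat q s₁ * Jhat q s₂ ∂((Measure.dirac (0 : ℝ)).prod μG')
      = Gt s₁ * (1 - Gt s₂) := by
    rw [integral_prod _ (hint _), integral_dirac]
    simp only [hJhat, lt_irrefl, if_false, h0, h0.trans h12, true_and, hGtdef]
    exact integral_centered_ite_lt_mul μG' h12
  rw [hΛ, integral_add_measure (hint _) ((hint _).smul_measure ENNReal.ofReal_ne_top),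
    integral_smul_measure, harrival, hinitial, ENNReal.toReal_ofReal hx, smul_eq_mul, mul_assoc]
end

section
/- Let T > 0, β ∈ (0,1], x ≥ 0, let α be a finite measure on [0,T], and let G, G̃ be cumulative distribution functions of probability measures on [0,∞). Assume that for all s, s′ ∈ [0,T]: |(G∗α)(s′) − (G∗α)(s)| ≤ c_{G,α}|s′−s|^β where (G∗α)(s) := ∫_{[0,s]} G(s−u) α(du); |A(s′) − A(s)| ≤ c_α|s′−s|^β where A(s) := α([0,s]); and |G̃(s′) − G̃(s)| ≤ c_G̃|s′−s|^β. Define K(s₁,s₂) := ∫_{[0,s₁]}(1 − G(s₂ − t)) α(dt) + x G̃(s₁)(1 − G̃(s₂)) for 0 ≤ s₁ ≤ s₂ ≤ T. Then for all 0 ≤ s ≤ s+h ≤ T with 0 ≤ h ≤ 1: |K(s+h, s+h) − K(s, s+h)| ≤ (c_{G,α} + c_α + x c_G̃) h^β and |K(s,s) − K(s, s+h)| ≤ (c_{G,α} + c_α + x c_G̃) h^β; consequently K(s+h,s+h) − 2K(s,s+h) + K(s,s) ≤ 2(c_{G,α} + c_α + x c_G̃) h^β. -/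
open Set MeasureTheory Filter
open scoped NNReal ENNReal

/-- Increment bounds for the covariance function of the Gaussian limit of the heavy-traffic
M/GI/∞ queue, under Hölder continuity of `G∗α`, `A` and `G̃`. -/
theorem stmt15 (T : ℝ) (hT : 0 < T) (β : ℝ) (hβ0 : 0 < β) (hβ1 : β ≤ 1)
    (x : ℝ) (hx : 0 ≤ x)
    (α : Measure ℝ) [IsFiniteMeasure α]
    (μG μG' : Measure ℝ) [IsProbabilityMeasure μG] [IsProbabilityMeasure μG']
    (hμG : μG (Set.Iio (0:ℝ)) = 0) (hμG' : μG' (Set.Iio (0:ℝ)) = 0)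
    (G Gt : ℝ → ℝ)
    (hGdef : ∀ u, G u = (μG (Set.Iic u)).toReal)
    (hGtdef : ∀ u, Gt u = (μG' (Set.Iic u)).toReal)
    (cGα cα cGt : ℝ)
    (hHolder1 : ∀ s t : ℝ, s ∈ Set.Icc (0:ℝ) T → t ∈ Set.Icc (0:ℝ) T →
      |(∫ u in Set.Icc (0:ℝ) s, G (s - u) ∂α) - ∫ u in Set.Icc (0:ℝ) t, G (t - u) ∂α|
        ≤ cGα * |s - t| ^ β)
    (hHolder2 : ∀ s t : ℝ, s ∈ Set.Icc (0:ℝ) T → t ∈ Set.Icc (0:ℝ) T →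
      |(α (Set.Icc (0:ℝ) s)).toReal - (α (Set.Icc (0:ℝ) t)).toReal| ≤ cα * |s - t| ^ β)
    (hHolder3 : ∀ s t : ℝ, s ∈ Set.Icc (0:ℝ) T → t ∈ Set.Icc (0:ℝ) T →
      |Gt s - Gt t| ≤ cGt * |s - t| ^ β)
    (K : ℝ → ℝ → ℝ)
    (hK : ∀ s₁ s₂ : ℝ, K s₁ s₂ =
      (∫ t in Set.Icc (0:ℝ) s₁, (1 - G (s₂ - t)) ∂α) + x * Gt s₁ * (1 - Gt s₂))
    (s h : ℝ) (hs : 0 ≤ s) (hh0 : 0 ≤ h) (hh1 : h ≤ 1) (hsh : s + h ≤ T) :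
    |K (s + h) (s + h) - K s (s + h)| ≤ (cGα + cα + x * cGt) * h ^ β ∧
    |K s s - K s (s + h)| ≤ (cGα + cα + x * cGt) * h ^ β ∧
    K (s + h) (s + h) - 2 * K s (s + h) + K s s ≤ 2 * (cGα + cα + x * cGt) * h ^ β := by
  have hG0 : ∀ u, 0 ≤ G u := fun u => by rw [hGdef]; exact ENNReal.toReal_nonneg
  have hG1 : ∀ u, G u ≤ 1 := fun u => by rw [hGdef]; exact measureReal_le_one
  have hGt0 : ∀ u, 0 ≤ Gt u := fun u => by rw [hGtdef]; exact ENNReal.toReal_nonneg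
  have hGt1 : ∀ u, Gt u ≤ 1 := fun u => by rw [hGtdef]; exact measureReal_le_one
  have hGmono : Monotone G := fun u v huv => by
    rw [hGdef, hGdef]
    exact measureReal_mono (Set.Iic_subset_Iic.2 huv)
  have hGtmono : Monotone Gt := fun u v huv => by
    rw [hGtdef, hGtdef]
    exact measureReal_mono (Set.Iic_subset_Iic.2 huv)
  have hint : ∀ r : ℝ, Integrable (fun t => G (r - t)) α := fun r => by
    refine Integrable.of_bound
      (hGmono.measurable.comp (measurable_const.sub measurable_id)).aestronglyMeasurable 1
      (Filter.Eventually.of_forall fun t => ?_)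
    rw [Real.norm_eq_abs, abs_of_nonneg (hG0 _)]
    exact hG1 _
  have hunion : Set.Icc (0:ℝ) (s + h) = Set.Icc 0 s ∪ Set.Ioc s (s + h) :=
    (Set.Icc_union_Ioc_eq_Icc hs (by linarith)).symm
  have hdisj : Disjoint (Set.Icc (0:ℝ) s) (Set.Ioc s (s + h)) :=
    Set.disjoint_left.2 fun t ht ht' => absurd ht.2 (not_le.2 ht'.1)
  have hcompl : ∀ (r : ℝ) (S : Set ℝ),
      ∫ t in S, (1 - G (r - t)) ∂α = (α S).toReal - ∫ t in S, G (r - t) ∂α := fun r S => by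
    rw [integral_sub (integrable_const _) (hint r).integrableOn]
    simp [Measure.real]
  have hsplit : ∫ t in Set.Icc (0:ℝ) (s + h), G (s + h - t) ∂α =
      (∫ t in Set.Icc (0:ℝ) s, G (s + h - t) ∂α) + ∫ t in Set.Ioc s (s + h), G (s + h - t) ∂α := by
    rw [hunion]
    exact setIntegral_union hdisj measurableSet_Ioc (hint _).integrableOn (hint _).integrableOn
  have hmass : (α (Set.Icc (0:ℝ) (s + h))).toReal =
      (α (Set.Icc (0:ℝ) s)).toReal + (α (Set.Ioc s (s + h))).toReal := by
    rw [hunion]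
    exact measureReal_union hdisj measurableSet_Ioc
  have hb0 : 0 ≤ ∫ t in Set.Ioc s (s + h), G (s + h - t) ∂α :=
    integral_nonneg fun t => hG0 _
  have hb1 : 0 ≤ ∫ t in Set.Ioc s (s + h), (1 - G (s + h - t)) ∂α :=
    integral_nonneg fun t => sub_nonneg.2 (hG1 _)
  have hca : ∫ t in Set.Icc (0:ℝ) s, G (s - t) ∂α ≤ ∫ t in Set.Icc (0:ℝ) s, G (s + h - t) ∂α :=
    integral_mono (hint _).integrableOn (hint _).integrableOn fun t => hGmono (by linarith)
  have hs_mem : s ∈ Set.Icc (0:ℝ) T := ⟨hs, by linarith⟩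
  have hsh_mem : s + h ∈ Set.Icc (0:ℝ) T := ⟨by linarith, hsh⟩
  have hdist : |s + h - s| = h := by rw [add_sub_cancel_left, abs_of_nonneg hh0]
  have h1 := hHolder1 (s + h) s hsh_mem hs_mem
  have h2 := hHolder2 (s + h) s hsh_mem hs_mem
  have h3 := hHolder3 (s + h) s hsh_mem hs_mem
  rw [hdist] at h1 h2 h3
  have h1n := (abs_nonneg _).trans h1
  have h2n := (abs_nonneg _).trans h2
  have h1' := (le_abs_self _).trans h1
  have h2' := (le_abs_self _).trans h2
  have h3' := (le_abs_self _).trans h3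
  have hd : 0 ≤ Gt (s + h) - Gt s := sub_nonneg.2 (hGtmono (by linarith))
  have hxd : 0 ≤ x * (Gt (s + h) - Gt s) := mul_nonneg hx hd
  have hxd' : x * (Gt (s + h) - Gt s) ≤ x * (cGt * h ^ β) := mul_le_mul_of_nonneg_left h3' hx
  have hp0 := mul_nonneg hxd (sub_nonneg.2 (hGt1 (s + h)))
  have hp1 := mul_nonneg hxd (hGt0 (s + h))
  have hq0 := mul_nonneg hxd (hGt0 s)
  have hq1 := mul_nonneg hxd (sub_nonneg.2 (hGt1 s))
  rw [hcompl] at hb1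
  have hdiag : |K (s + h) (s + h) - K s (s + h)| ≤ (cGα + cα + x * cGt) * h ^ β := by
    rw [hK, hK, hcompl, hcompl, hsplit, hmass, abs_le]
    constructor <;> linarith
  have hoff : |K s s - K s (s + h)| ≤ (cGα + cα + x * cGt) * h ^ β := by
    rw [hK, hK, hcompl, hcompl, abs_le]
    constructor <;> linarith
  refine ⟨hdiag, hoff, ?_⟩
  linarith [le_of_abs_le hdiag, le_of_abs_le hoff]
end

section
/- Let T > 0, m > 0, v > 0, and let G be the cumulative distribution function of a probability measure μ_G on [0,∞); put Ḡ := 1 − G. On S = [0,T]×[0,∞), let Λ be the product of Lebesgue measure on [0,T] with μ_G, and define Ĵ_{t,y}(s) := (m/v)·1[t ≤ s < t+y] − ((m+v)/v)·Ḡ(s−t)·1[s ≥ t]. Then for all 0 ≤ s₁ ≤ s₂ ≤ T: ∫_S Ĵ_{t,y}(s₁) Ĵ_{t,y}(s₂) Λ(dt,dy) = (m²/v²) ∫₀^{s₁} Ḡ(s₂ − t) G(s₁ − t) dt + ∫₀^{s₁} Ḡ(s₁ − t) Ḡ(s₂ − t) dt. -/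
open Set MeasureTheory Filter
open scoped NNReal ENNReal

/-- The tail `y > u` has mass `1 - μ (Iic u)` under a probability measure. -/
theorem integral_indicator_Ioi_one (μ : Measure ℝ) [IsProbabilityMeasure μ] (u : ℝ) :
    ∫ y, (Ioi u).indicator (fun _ => (1 : ℝ)) y ∂μ = 1 - (μ (Iic u)).toReal := by
  rw [integral_indicator_const _ measurableSet_Ioi, ← compl_Iic,
    probReal_compl_eq_one_sub measurableSet_Iic, smul_eq_mul, mul_one, Measure.real]

/-- Second moment of two affinely transformed tail indicators at levels `u ≤ w`. -/
theorem integral_mul_affine_indicator_Ioi (μ : Measure ℝ) [IsProbabilityMeasure μ] {u w : ℝ}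
    (huw : u ≤ w) (a b c : ℝ) :
    ∫ y, (a * (Ioi u).indicator (fun _ => (1 : ℝ)) y - b)
        * (a * (Ioi w).indicator (fun _ => (1 : ℝ)) y - c) ∂μ
      = a ^ 2 * (1 - (μ (Iic w)).toReal) - a * c * (1 - (μ (Iic u)).toReal)
        - a * b * (1 - (μ (Iic w)).toReal) + b * c := by
  have hi : ∀ x : ℝ, Integrable ((Ioi x).indicator (fun _ => (1 : ℝ))) μ := fun x =>
    (integrable_const _).indicator measurableSet_Ioi
  have hexp : ∀ y, (a * (Ioi u).indicator (fun _ => (1 : ℝ)) y - b)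
        * (a * (Ioi w).indicator (fun _ => (1 : ℝ)) y - c)
      = (a ^ 2 - a * b) * (Ioi w).indicator (fun _ => (1 : ℝ)) y
        - a * c * (Ioi u).indicator (fun _ => (1 : ℝ)) y + b * c := by
    intro y
    by_cases hw : w < y
    · simp only [indicator, mem_Ioi, hw, huw.trans_lt hw, if_true]
      ring
    · simp only [indicator, mem_Ioi, hw, if_false]
      ring
  have hsub : Integrable (fun y => (a ^ 2 - a * b) * (Ioi w).indicator (fun _ => (1 : ℝ)) y
      - a * c * (Ioi u).indicator (fun _ => (1 : ℝ)) y) μ :=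
    ((hi w).const_mul _).sub ((hi u).const_mul _)
  simp_rw [hexp]
  rw [integral_add hsub (integrable_const _),
    integral_sub ((hi w).const_mul _) ((hi u).const_mul _), integral_const_mul,
    integral_const_mul, integral_indicator_Ioi_one, integral_indicator_Ioi_one]
  simp only [integral_const, probReal_univ, one_smul]
  ring

/-- Covariance identity for the Gaussian limit of the heavy-traffic GI/GI/∞ queue:
with `Λ = Leb|_{[0,T]} × μ_G` and
`Ĵ_{t,y}(s) = (m/v)1[t ≤ s < t+y] - ((m+v)/v) Ḡ(s-t) 1[s ≥ t]`, one has
`∫_S Ĵ_{t,y}(s₁)Ĵ_{t,y}(s₂) Λ(dt,dy)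
   = (m²/v²)∫₀^{s₁} Ḡ(s₂-t)G(s₁-t) dt + ∫₀^{s₁} Ḡ(s₁-t)Ḡ(s₂-t) dt`
for `0 ≤ s₁ ≤ s₂ ≤ T`. -/
theorem stmt16 (T m v : ℝ) (hT : 0 < T) (hm : 0 < m) (hv : 0 < v)
    (μG : Measure ℝ) [IsProbabilityMeasure μG] (hμG : μG (Set.Iio (0:ℝ)) = 0)
    (G : ℝ → ℝ) (hGdef : ∀ u, G u = (μG (Set.Iic u)).toReal)
    (Jhat : ℝ × ℝ → ℝ → ℝ)
    (hJhat : ∀ t y s : ℝ, Jhat (t, y) s =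
      (m / v) * (if t ≤ s ∧ s < t + y then 1 else 0)
        - ((m + v) / v) * (1 - G (s - t)) * (if t ≤ s then 1 else 0))
    (s₁ s₂ : ℝ) (h0 : 0 ≤ s₁) (h12 : s₁ ≤ s₂) (h2T : s₂ ≤ T) :
    ∫ q, Jhat q s₁ * Jhat q s₂ ∂((MeasureTheory.volume.restrict (Set.Icc (0:ℝ) T)).prod μG)
      = (m ^ 2 / v ^ 2) * (∫ t in (0:ℝ)..s₁, (1 - G (s₂ - t)) * G (s₁ - t))
        + ∫ t in (0:ℝ)..s₁, (1 - G (s₁ - t)) * (1 - G (s₂ - t)) := by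
  have hG : Measurable G := by
    refine Monotone.measurable fun x y hxy => ?_
    rw [hGdef, hGdef]
    exact ENNReal.toReal_mono (measure_ne_top _ _) (measure_mono (Iic_subset_Iic.2 hxy))
  have hG0 : ∀ u, 0 ≤ G u := fun u => by rw [hGdef]; exact ENNReal.toReal_nonneg
  have hG1 : ∀ u, G u ≤ 1 := fun u => by
    rw [hGdef]; exact ENNReal.toReal_le_of_le_ofReal zero_le_one (by simpa using prob_le_one)
  have hJmeas : ∀ s, Measurable fun q => Jhat q s := by
    intro s
    have : (fun q => Jhat q s) = fun q : ℝ × ℝ =>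
        (m / v) * (if q.1 ≤ s ∧ s < q.1 + q.2 then 1 else 0)
          - ((m + v) / v) * (1 - G (s - q.1)) * (if q.1 ≤ s then 1 else 0) :=
      funext fun q => hJhat q.1 q.2 s
    rw [this]
    have hle : MeasurableSet {q : ℝ × ℝ | q.1 ≤ s} :=
      measurableSet_le measurable_fst measurable_const
    have hlt : MeasurableSet {q : ℝ × ℝ | s < q.1 + q.2} :=
      measurableSet_lt measurable_const (measurable_fst.add measurable_snd)
    exact ((Measurable.ite (hle.inter hlt) measurable_const measurable_const).const_mul _).sub
      ((((hG.comp (measurable_const.sub measurable_fst)).const_sub 1).const_mul _).mul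
        (Measurable.ite hle measurable_const measurable_const))
  have hJbdd : ∀ q s, ‖Jhat q s‖ ≤ m / v + (m + v) / v := by
    rintro ⟨t, y⟩ s
    have ha : 0 ≤ m / v := by positivity
    have hb : 0 ≤ (m + v) / v := by positivity
    have h1 : (m + v) / v * (1 - G (s - t)) ≤ (m + v) / v :=
      mul_le_of_le_one_right hb (by linarith [hG0 (s - t)])
    have h2 : 0 ≤ (m + v) / v * (1 - G (s - t)) :=
      mul_nonneg hb (by linarith [hG1 (s - t)])
    rw [hJhat, Real.norm_eq_abs, abs_le]
    split_ifs <;> constructor <;> linarith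
  have hint : Integrable (fun q => Jhat q s₁ * Jhat q s₂)
      ((volume.restrict (Icc (0 : ℝ) T)).prod μG) := by
    refine Integrable.of_bound ((hJmeas s₁).mul (hJmeas s₂)).aestronglyMeasurable
      ((m / v + (m + v) / v) * (m / v + (m + v) / v)) (ae_of_all _ fun q => ?_)
    rw [norm_mul]
    exact mul_le_mul (hJbdd q s₁) (hJbdd q s₂) (norm_nonneg _) (by positivity)
  have hinner : ∀ t, ∫ y, Jhat (t, y) s₁ * Jhat (t, y) s₂ ∂μG
      = (Iic s₁).indicator (fun t => m ^ 2 / v ^ 2 * ((1 - G (s₂ - t)) * G (s₁ - t))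
          + (1 - G (s₁ - t)) * (1 - G (s₂ - t))) t := by
    intro t
    by_cases ht : t ≤ s₁
    · have hJ : ∀ s, t ≤ s → ∀ y, Jhat (t, y) s
          = m / v * (Ioi (s - t)).indicator (fun _ => (1 : ℝ)) y
            - (m + v) / v * (1 - G (s - t)) := by
        intro s hs y
        simp only [hJhat, hs, true_and, if_true, mul_one, indicator, mem_Ioi, sub_lt_iff_lt_add']
      simp_rw [hJ s₁ ht, hJ s₂ (ht.trans h12)]
      rw [integral_mul_affine_indicator_Ioi μG (sub_le_sub_right h12 t), ← hGdef, ← hGdef,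
        indicator_of_mem (mem_Iic.2 ht)]
      field_simp
      ring
    · have hz : ∀ y, Jhat (t, y) s₁ = 0 := fun y => by simp [hJhat, ht]
      simp [hz, ht]
  have hInt : ∀ f : ℝ → ℝ, Measurable f → (∀ t, 0 ≤ f t) → (∀ t, f t ≤ 1) →
      IntervalIntegrable f volume 0 s₁ := fun f hf hf0 hf1 =>
    (intervalIntegrable_const (c := (1 : ℝ))).mono_fun hf.aestronglyMeasurable
      (ae_of_all _ fun t => by simpa [abs_of_nonneg (hf0 t)] using hf1 t)
  have hGs : ∀ s, Measurable fun t => G (s - t) := fun s =>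
    hG.comp (measurable_const.sub measurable_id)
  have hT0 : ∀ u, 0 ≤ 1 - G u := fun u => sub_nonneg.2 (hG1 u)
  have hT1 : ∀ u, 1 - G u ≤ 1 := fun u => sub_le_self _ (hG0 u)
  have hI1 := hInt (fun t => (1 - G (s₂ - t)) * G (s₁ - t))
    (((hGs s₂).const_sub 1).mul (hGs s₁)) (fun t => mul_nonneg (hT0 _) (hG0 _))
    (fun t => mul_le_one₀ (hT1 _) (hG0 _) (hG1 _))
  have hI2 := hInt (fun t => (1 - G (s₁ - t)) * (1 - G (s₂ - t)))
    (((hGs s₁).const_sub 1).mul ((hGs s₂).const_sub 1)) (fun t => mul_nonneg (hT0 _) (hT0 _))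
    (fun t => mul_le_one₀ (hT1 _) (hT0 _) (hT1 _))
  have hset : Icc (0 : ℝ) T ∩ Iic s₁ = Icc 0 s₁ := by
    ext t
    simp only [mem_inter_iff, mem_Icc, mem_Iic]
    exact ⟨fun h => ⟨h.1.1, h.2⟩, fun h => ⟨⟨h.1, h.2.trans (h12.trans h2T)⟩, h.2⟩⟩
  rw [integral_prod _ hint]
  simp_rw [hinner]
  rw [setIntegral_indicator measurableSet_Iic, hset, integral_Icc_eq_integral_Ioc,
    ← intervalIntegral.integral_of_le h0, intervalIntegral.integral_add (hI1.const_mul _) hI2,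
    intervalIntegral.integral_const_mul]
end

section
/- For w ∈ [0,1] define q_w : (0,1] → ℝ by q_w(u) := w·1[u ≤ 1−w] + (1−w)·1[u > 1−w] if w ≥ 1/2, and q_w(u) := (1−w)·1[u ≤ w] + w·1[u > w] if w < 1/2. Let r > 2 be real, l ≥ 1 an integer with 2l < r, and k ≥ 1 real. Then there exists a constant c depending only on r, l, k such that for every w ∈ (0,1]: ∫₀¹ ( 2 (k/u)^{1/(r−1)} )^{2l−1} q_w(u)^{2l} du ≤ c · w^{(r−2l)/(r−1)}. -/
open Set MeasureTheory Filter
open scoped NNReal ENNReal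

noncomputable section

/-- The quantile function of the centered two-valued random variable taking values
`-w` and `1-w` with probabilities `1-w` and `w`. -/
def qfun (w u : ℝ) : ℝ :=
  if (1/2 : ℝ) ≤ w then (if u ≤ 1 - w then w else 1 - w)
  else (if u ≤ w then 1 - w else w)

lemma qfun_nonneg {w u : ℝ} (hw : 0 ≤ w) (hw1 : w ≤ 1) : 0 ≤ qfun w u := by
  unfold qfun
  split_ifs <;> linarith

lemma qfun_pow_le {w u : ℝ} (hw : 0 ≤ w) (hw1 : w ≤ 1) {n : ℕ} (hn : n ≠ 0) :
    qfun w u ^ n ≤ (Iic w).indicator 1 u + 2 * w := by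
  have h0 : 0 ≤ qfun w u := qfun_nonneg hw hw1
  have h1 : qfun w u ≤ 1 := by
    unfold qfun
    split_ifs <;> linarith
  refine (pow_le_of_le_one h0 h1 hn).trans ?_
  by_cases hu : u ≤ w
  · rw [indicator_of_mem (mem_Iic.2 hu), Pi.one_apply]
    linarith
  · rw [indicator_of_notMem (by simpa using hu), zero_add]
    unfold qfun
    split_ifs <;> linarith

lemma integrableOn_Ioc_rpow_neg {s w : ℝ} (hs : s < 1) (hw : 0 ≤ w) :
    IntegrableOn (fun u : ℝ => u ^ (-s)) (Ioc 0 w) :=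
  (intervalIntegrable_iff_integrableOn_Ioc_of_le hw).1
    (intervalIntegral.intervalIntegrable_rpow' (by linarith))

lemma setIntegral_Ioc_rpow_neg {s w : ℝ} (hs : s < 1) (hw : 0 ≤ w) :
    ∫ u in Ioc 0 w, u ^ (-s) = w ^ (1 - s) / (1 - s) := by
  rw [← intervalIntegral.integral_of_le hw, integral_rpow (Or.inl (by linarith)),
    neg_add_eq_sub, Real.zero_rpow (by linarith), sub_zero]

lemma setIntegral_rpow_neg_mul_qfun_pow_le {s w : ℝ} (hs0 : 0 ≤ s) (hs : s < 1) (hw : 0 < w)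
    (hw1 : w ≤ 1) {n : ℕ} (hn : n ≠ 0) :
    ∫ u in Ioc 0 1, u ^ (-s) * qfun w u ^ n ≤ 3 / (1 - s) * w ^ (1 - s) := by
  have hint := integrableOn_Ioc_rpow_neg hs zero_le_one
  have hint' := hint.indicator (measurableSet_Iic (a := w))
  have hww : w ≤ w ^ (1 - s) := Real.self_le_rpow_of_le_one hw.le hw1 (by linarith)
  have hs' : 0 < 1 - s := by linarith
  calc
    _ ≤ ∫ u in Ioc 0 1, ((Iic w).indicator (fun u : ℝ => u ^ (-s)) u + 2 * w * u ^ (-s)) := by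
      refine integral_mono_of_nonneg ?_ (hint'.add (hint.const_mul _)) ?_ <;>
        filter_upwards [ae_restrict_mem measurableSet_Ioc] with u hu
      · exact mul_nonneg (Real.rpow_nonneg hu.1.le _) (pow_nonneg (qfun_nonneg hw.le hw1) _)
      · refine (mul_le_mul_of_nonneg_left (qfun_pow_le hw.le hw1 hn)
          (Real.rpow_nonneg hu.1.le _)).trans_eq ?_
        by_cases h : u ∈ Iic w <;> simp only [h, indicator_of_mem, indicator_of_notMem,
          not_false_eq_true, Pi.one_apply] <;> ring
    _ = w ^ (1 - s) / (1 - s) + 2 * w * (1 / (1 - s)) := by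
      rw [integral_add hint' (hint.const_mul _), setIntegral_indicator measurableSet_Iic,
        Ioc_inter_Iic, min_eq_right hw1, integral_const_mul,
        setIntegral_Ioc_rpow_neg hs hw.le, setIntegral_Ioc_rpow_neg hs zero_le_one,
        Real.one_rpow]
    _ ≤ w ^ (1 - s) / (1 - s) + 2 * w ^ (1 - s) * (1 / (1 - s)) := by gcongr
    _ = 3 / (1 - s) * w ^ (1 - s) := by ring

/-- Rio-type moment integral bound: for `r > 2`, `1 ≤ l` with `2l < r` and `k ≥ 1`, there is a
constant `c = c(r,l,k)` such that for all `w ∈ (0,1]`,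
`∫₀¹ (2 (k/u)^{1/(r-1)})^{2l-1} q_w(u)^{2l} du ≤ c · w^{(r-2l)/(r-1)}`. -/
theorem stmt17 (r : ℝ) (hr : 2 < r) (l : ℕ) (hl : 1 ≤ l)
    (h2l : 2 * (l : ℝ) < r) (k : ℝ) (hk : 1 ≤ k) :
    ∃ c : ℝ, ∀ w : ℝ, 0 < w → w ≤ 1 →
      (∫ u in Set.Ioc (0:ℝ) 1,
          (2 * (k / u) ^ ((1:ℝ) / (r - 1))) ^ (2 * l - 1) * (qfun w u) ^ (2 * l))
        ≤ c * w ^ ((r - 2 * (l : ℝ)) / (r - 1)) := by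
  have hl' : (1 : ℝ) ≤ l := by exact_mod_cast hl
  have hr1 : 0 < r - 1 := by linarith
  have hcast : ((2 * l - 1 : ℕ) : ℝ) = 2 * l - 1 := by
    rw [Nat.cast_sub (by omega)]
    push_cast
    ring
  set s : ℝ := (2 * l - 1) / (r - 1) with hs_def
  have hs0 : 0 ≤ s := div_nonneg (by linarith) hr1.le
  have hs1 : s < 1 := (div_lt_one hr1).2 (by linarith)
  have hexp : (r - 2 * (l : ℝ)) / (r - 1) = 1 - s := by
    rw [hs_def]
    field_simp
    ring
  have hpow : ∀ u : ℝ, 0 < u →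
      (2 * (k / u) ^ ((1:ℝ) / (r - 1))) ^ (2 * l - 1) = 2 ^ (2 * l - 1) * k ^ s * u ^ (-s) := by
    intro u hu
    rw [mul_pow, ← Real.rpow_mul_natCast (by positivity), hcast, one_div_mul_eq_div, ← hs_def,
      Real.div_rpow (by linarith) hu.le, Real.rpow_neg hu.le, div_eq_mul_inv, mul_assoc]
  refine ⟨2 ^ (2 * l - 1) * k ^ s * (3 / (1 - s)), fun w hw hw1 => ?_⟩
  rw [hexp, setIntegral_congr_fun (g := fun u => 2 ^ (2 * l - 1) * k ^ s *
      (u ^ (-s) * qfun w u ^ (2 * l))) measurableSet_Ioc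
      (fun u hu => by simp only [hpow u hu.1, mul_assoc]),
    integral_const_mul, mul_assoc _ (3 / (1 - s))]
  exact mul_le_mul_of_nonneg_left
    (setIntegral_rpow_neg_mul_qfun_pow_le hs0 hs1 hw hw1 (by omega)) (by positivity)

end
end
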